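/- There exists a constant C_n < ∞ depending only on n such that for all 0 < t₁ ≤ t₂, |B(t₂) − B(t₁)| ≤ C_n ∫_{t₁}^{t₂} F(s) ds, where F(s) := ∫_{Λ_s ∩ B₁} |x|² dx and |·| is the Frobenius norm on matrices. -/

import Mathlib

open MeasureTheory Metric Filter Topology Pointwise

noncomputable section

abbrev En (n : ℕ) := EuclideanSpace ℝ (Fin n)

/-- symmetric trace-free matrices -/
def S0 {n : ℕ} (B : Matrix (Fin n) (Fin n) ℝ) : Prop := B.IsSymm ∧ B.trace = 0

/-- ψ_B(x) = (1/2) x·Bx -/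
def psiM {n : ℕ} (B : Matrix (Fin n) (Fin n) ℝ) (x : En n) : ℝ :=
  (1/2) * ∑ i, ∑ j, B i j * x i * x j

/-- p₀(x) = |x|²/(2n) -/
def p0 (n : ℕ) (x : En n) : ℝ := ‖x‖^2 / (2*n)

/-- q_B = p₀ + ψ_B -/
def qB {n : ℕ} (B : Matrix (Fin n) (Fin n) ℝ) (x : En n) : ℝ := p0 n x + psiM B x

/-- surface measure on the unit sphere -/
def sphMeas (n : ℕ) : Measure (En n) :=
  (Measure.hausdorffMeasure ((n:ℝ) - 1)).restrict (sphere (0:En n) 1)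

/-- total surface area of the unit sphere -/
def sphArea (n : ℕ) : ℝ := (sphMeas n Set.univ).toReal

/-- u is a C^{1,1} solution of Δu = χ_{|∇u|>0} in B₁ with 0 a free boundary point. -/
def SolutionHyp {n : ℕ} (u : En n → ℝ) : Prop :=
  (∀ x ∈ ball (0:En n) 1, DifferentiableAt ℝ u x) ∧
  (∃ L : NNReal, LipschitzOnWith L (fun x => gradient u x) (ball (0:En n) 1)) ∧
  (∀ᵐ x ∂(volume.restrict (ball (0:En n) 1)),
      ∃ D : En n →L[ℝ] En n, HasFDerivAt (fun y => gradient u y) D x ∧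
        ((gradient u x = 0 → LinearMap.trace ℝ (En n) (D : En n →ₗ[ℝ] En n) = 0) ∧
         (gradient u x ≠ 0 → LinearMap.trace ℝ (En n) (D : En n →ₗ[ℝ] En n) = 1))) ∧
  ((0:En n) ∈ frontier {x | x ∈ ball (0:En n) 1 ∧ gradient u x ≠ 0}) ∧
  gradient u 0 = 0

/-- the quadratic rescaling u_t(x) = e^{2t}(u(e^{-t}x)-u(0)) -/
def ut {n : ℕ} (u : En n → ℝ) (t : ℝ) (x : En n) : ℝ :=
  Real.exp (2*t) * (u (Real.exp (-t) • x) - u 0)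

/-- Λ = {x ∈ B₁ : ∇u(x)=0} -/
def Lam {n : ℕ} (u : En n → ℝ) : Set (En n) :=
  {x | x ∈ ball (0:En n) 1 ∧ gradient u x = 0}

/-- Λ_t = e^t Λ -/
def LamT {n : ℕ} (u : En n → ℝ) (t : ℝ) : Set (En n) := Real.exp t • Lam u

/-- B(t) is the L²(∂B₁)-projection coefficient of u_t - p₀ -/
def BProp {n : ℕ} (u : En n → ℝ) (B : ℝ → Matrix (Fin n) (Fin n) ℝ) : Prop :=
  ∀ t, 0 < t → S0 (B t) ∧
    ∀ C, S0 C →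
      ∫ x, (ut u t x - p0 n x - psiM (B t) x) * psiM C x ∂(sphMeas n) = 0

/-- remainder R_t = u_t - q_{B(t)} -/
def Rt {n : ℕ} (u : En n → ℝ) (B : ℝ → Matrix (Fin n) (Fin n) ℝ) (t : ℝ) (x : En n) : ℝ :=
  ut u t x - qB (B t) x

/-- F(t) = ∫_{Λ_t ∩ B₁} |x|² dx -/
def Fdef {n : ℕ} (u : En n → ℝ) (t : ℝ) : ℝ :=
  ∫ x in LamT u t ∩ ball (0:En n) 1, ‖x‖^2

/-- I(t) = ∫_{Λ_t ∩ B₁} x·∇R_t dx -/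
def Idef {n : ℕ} (u : En n → ℝ) (B : ℝ → Matrix (Fin n) (Fin n) ℝ) (t : ℝ) : ℝ :=
  ∫ x in LamT u t ∩ ball (0:En n) 1, ∑ i, x i * gradient (Rt u B t) x i

/-- the origin is a singular point -/
def IsSingular {n : ℕ} (u : En n → ℝ) : Prop :=
  ∃ (r : ℕ → ℝ) (Bstar : Matrix (Fin n) (Fin n) ℝ),
    (∀ k, 0 < r k) ∧ Tendsto r atTop (nhds 0) ∧ S0 Bstar ∧
    (∀ K : Set (En n), IsCompact K →
      TendstoUniformlyOn (fun k x => (u (r k • x) - u 0) / (r k)^2) (qB Bstar) atTop K ∧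
      TendstoUniformlyOn (fun k x => gradient (fun y => (u (r k • y) - u 0) / (r k)^2) x)
        (fun x => gradient (qB Bstar) x) atTop K)

/-- Frobenius norm -/
def frob {n : ℕ} (M : Matrix (Fin n) (Fin n) ℝ) : ℝ := Real.sqrt (∑ i, ∑ j, (M i j)^2)

/-- the annulus 1/2 < |x| < 1 -/
def ann0 (n : ℕ) : Set (En n) := {x | 1/2 < ‖x‖ ∧ ‖x‖ < 1}

/-- the dyadic annulus 2^{-k-1} < |x| < 2^{-k} -/
def annK (n : ℕ) (k : ℕ) : Set (En n) :=
  {x | (2:ℝ)^(-(k:ℤ)-1) < ‖x‖ ∧ ‖x‖ < (2:ℝ)^(-(k:ℤ))}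

def F0 {n : ℕ} (u : En n → ℝ) (t : ℝ) : ℝ := ∫ x in LamT u t ∩ ann0 n, ‖x‖^2

def Fk {n : ℕ} (u : En n → ℝ) (k : ℕ) (t : ℝ) : ℝ := ∫ x in LamT u t ∩ annK n k, ‖x‖^2

def I0 {n : ℕ} (u : En n → ℝ) (B : ℝ → Matrix (Fin n) (Fin n) ℝ) (t : ℝ) : ℝ :=
  ∫ x in LamT u t ∩ ann0 n, ∑ i, x i * gradient (Rt u B t) x i

def Ik {n : ℕ} (u : En n → ℝ) (B : ℝ → Matrix (Fin n) (Fin n) ℝ) (k : ℕ) (t : ℝ) : ℝ :=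
  ∫ x in LamT u t ∩ annK n k, ∑ i, x i * gradient (Rt u B t) x i

/-- ε(t) = sup_{1/2 ≤ |x| ≤ 1} |∇R_t(x)| -/
def epsd {n : ℕ} (u : En n → ℝ) (B : ℝ → Matrix (Fin n) (Fin n) ℝ) (t : ℝ) : ℝ :=
  ⨆ x ∈ {x : En n | 1/2 ≤ ‖x‖ ∧ ‖x‖ ≤ 1}, ‖gradient (Rt u B t) x‖

/-- trace-free part of a matrix -/
def tf {n : ℕ} (M : Matrix (Fin n) (Fin n) ℝ) : Matrix (Fin n) (Fin n) ℝ :=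
  Matrix.of fun i j => M i j - (M.trace / n) * (if i = j then 1 else 0)

/-- second moment matrix of Λ_t ∩ B₁ -/
def momMat {n : ℕ} (u : En n → ℝ) (t : ℝ) : Matrix (Fin n) (Fin n) ℝ :=
  Matrix.of fun i j => ∫ x in LamT u t ∩ ball (0:En n) 1, x i * x j

/-- V(t) -/
def Vdef {n : ℕ} (u : En n → ℝ) (t : ℝ) : ℝ :=
  ∑' k : ℕ, (2:ℝ)^(-((k * (n+2) : ℕ) : ℤ)) * F0 u (t + k * Real.log 2) *
    ∫ τ in t..(t + k * Real.log 2), Fdef u τ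

/-- A measure carried by the unit sphere, absolutely continuous with respect to another such
measure, is a multiple of it as soon as both give all balls centred on the sphere and of the same
radius the same mass. -/
theorem exists_eq_smul_of_uniform {n : ℕ} (ρ μ : Measure (En n)) [IsFiniteMeasure ρ]
    [IsFiniteMeasure μ] (hac : ρ ≪ μ) (hμs : μ (sphere (0 : En n) 1)ᶜ = 0)
    (hρ : ∀ x ∈ sphere (0 : En n) 1, ∀ y ∈ sphere (0 : En n) 1, ∀ r,
      ρ (closedBall x r) = ρ (closedBall y r))
    (hμ : ∀ x ∈ sphere (0 : En n) 1, ∀ y ∈ sphere (0 : En n) 1, ∀ r,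
      μ (closedBall x r) = μ (closedBall y r)) :
    ∃ c : ENNReal, ρ = c • μ := by
  by_cases h0 : μ = 0
  · refine ⟨0, ?_⟩
    rw [h0] at hac ⊢
    simpa using Measure.absolutelyContinuous_zero_iff.1 hac
  have hs : ∀ᵐ x ∂μ, x ∈ sphere (0 : En n) 1 := mem_ae_iff.2 hμs
  have hd := Besicovitch.ae_tendsto_rnDeriv ρ μ
  have : (ae μ).NeBot := ae_neBot.2 h0
  obtain ⟨x₀, hx₀s, hx₀⟩ := (hs.and hd).exists
  refine ⟨ρ.rnDeriv μ x₀, ?_⟩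
  have : ρ.HaveLebesgueDecomposition μ := Measure.haveLebesgueDecomposition_of_sigmaFinite ρ μ
  refine (Measure.withDensity_rnDeriv_eq ρ μ hac).symm.trans ?_
  rw [← withDensity_const]
  refine withDensity_congr_ae ?_
  filter_upwards [hs, hd] with x hxs hx
  refine tendsto_nhds_unique hx (hx₀.congr fun r => ?_)
  rw [hρ x hxs x₀ hx₀s, hμ x hxs x₀ hx₀s]

/-- The surface measure on the unit sphere coming from polar coordinates, as a measure on the
whole space. -/
def polarSphMeas (n : ℕ) : Measure (En n) :=
  (volume : Measure (En n)).toSphere.map (↑)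

instance (n : ℕ) : IsFiniteMeasure (polarSphMeas n) := by
  unfold polarSphMeas; infer_instance

theorem exists_linearIsometryEquiv_map {n : ℕ} {x y : En n} (h : ‖x‖ = ‖y‖) :
    ∃ e : En n ≃ₗᵢ[ℝ] En n, e x = y :=
  ⟨_, Submodule.reflection_sub h⟩

theorem image_closedBall_inter_sphere {n : ℕ} (e : En n ≃ₗᵢ[ℝ] En n) (x : En n) (r : ℝ) :
    e '' (closedBall x r ∩ sphere 0 1) = closedBall (e x) r ∩ sphere 0 1 := by
  rw [Set.image_inter e.injective, LinearIsometryEquiv.image_closedBall,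
    LinearIsometryEquiv.image_sphere, map_zero]

theorem sphMeas_closedBall {n : ℕ} {x y : En n} (hx : x ∈ sphere (0 : En n) 1)
    (hy : y ∈ sphere (0 : En n) 1) (r : ℝ) :
    sphMeas n (closedBall x r) = sphMeas n (closedBall y r) := by
  obtain ⟨e, rfl⟩ := exists_linearIsometryEquiv_map (x := x) (y := y) (by simp_all)
  rw [sphMeas, Measure.restrict_apply measurableSet_closedBall,
    Measure.restrict_apply measurableSet_closedBall, ← image_closedBall_inter_sphere]
  exact (e.toIsometryEquiv.hausdorffMeasure_image _ _).symm

theorem polarSphMeas_apply {n : ℕ} {s : Set (En n)} (hs : MeasurableSet s) :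
    polarSphMeas n s = n * volume (Set.Ioo (0 : ℝ) 1 • (s ∩ sphere (0 : En n) 1)) := by
  rw [polarSphMeas, Measure.map_apply measurable_subtype_coe hs,
    Measure.toSphere_apply' _ (measurable_subtype_coe hs), Subtype.image_preimage_coe,
    Set.inter_comm]
  simp

theorem polarSphMeas_closedBall {n : ℕ} {x y : En n} (hx : x ∈ sphere (0 : En n) 1)
    (hy : y ∈ sphere (0 : En n) 1) (r : ℝ) :
    polarSphMeas n (closedBall x r) = polarSphMeas n (closedBall y r) := by
  obtain ⟨e, rfl⟩ := exists_linearIsometryEquiv_map (x := x) (y := y) (by simp_all)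
  rw [polarSphMeas_apply measurableSet_closedBall, polarSphMeas_apply measurableSet_closedBall,
    ← image_closedBall_inter_sphere]
  congr 1
  have h : Set.Ioo (0 : ℝ) 1 • (e '' (closedBall x r ∩ sphere 0 1)) =
      e '' (Set.Ioo (0 : ℝ) 1 • (closedBall x r ∩ sphere 0 1)) := by
    ext z
    simp only [Set.mem_smul, Set.mem_image]
    constructor
    · rintro ⟨c, hc, _, ⟨w, hw, rfl⟩, rfl⟩
      exact ⟨c • w, ⟨c, hc, w, hw, rfl⟩, by simp⟩
    · rintro ⟨_, ⟨c, hc, w, hw, rfl⟩, rfl⟩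
      exact ⟨c, hc, e w, ⟨w, hw, rfl⟩, by simp⟩
  rw [h]
  have himg : e '' (Set.Ioo (0 : ℝ) 1 • (closedBall x r ∩ sphere 0 1)) =
      e.symm ⁻¹' (Set.Ioo (0 : ℝ) 1 • (closedBall x r ∩ sphere 0 1)) :=
    e.toEquiv.image_eq_preimage_symm _
  rw [himg]
  exact (e.symm.measurePreserving.measure_preimage_equiv (f := e.symm.toMeasurableEquiv) _).symm

theorem polarSphMeas_compl_sphere (n : ℕ) : polarSphMeas n (sphere (0 : En n) 1)ᶜ = 0 := by
  rw [polarSphMeas, Measure.map_apply measurable_subtype_coe isClosed_sphere.measurableSet.compl]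
  have : ((↑) : sphere (0 : En n) 1 → En n) ⁻¹' (sphere (0 : En n) 1)ᶜ = ∅ := by
    ext x
    simp
  rw [this, measure_empty]

theorem polarSphMeas_ne_zero {n : ℕ} (hn : 2 ≤ n) : polarSphMeas n ≠ 0 := by
  have : Nonempty (Fin n) := ⟨⟨0, by omega⟩⟩
  rw [polarSphMeas, Ne, Measure.map_eq_zero_iff measurable_subtype_coe.aemeasurable]
  exact Measure.toSphere_ne_zero _

theorem sphMeas_compl_sphere (n : ℕ) : sphMeas n (sphere (0 : En n) 1)ᶜ = 0 := by
  rw [sphMeas, Measure.restrict_apply isClosed_sphere.measurableSet.compl]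
  simp

/-- The radial projection of a facet of the cube `[-1, 1] ^ (m + 1)` onto the sphere. -/
def facetToSphere {m : ℕ} (i : Fin (m + 1)) (s : ℝ) (y : Fin m → ℝ) : En (m + 1) :=
  (‖WithLp.toLp 2 (i.insertNth s y : Fin (m + 1) → ℝ)‖⁻¹) •
    WithLp.toLp 2 (i.insertNth s y : Fin (m + 1) → ℝ)

theorem contDiff_facetToSphere {m : ℕ} (i : Fin (m + 1)) {s : ℝ} (hs : s ≠ 0) :
    ContDiff ℝ 1 (facetToSphere i s) := by
  have h1 : ContDiff ℝ 1 (fun y : Fin m → ℝ =>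
      (WithLp.toLp 2 (i.insertNth s y : Fin (m + 1) → ℝ) : En (m + 1))) := by
    rw [contDiff_euclidean]
    intro j
    refine Fin.succAboveCases i ?_ (fun k => ?_) j
    · simpa using contDiff_const
    · simpa using contDiff_apply ℝ ℝ k
  have h0 : ∀ y : Fin m → ℝ,
      (WithLp.toLp 2 (i.insertNth s y : Fin (m + 1) → ℝ) : En (m + 1)) ≠ 0 := by
    intro y h
    apply hs
    simpa using congrArg (fun z : En (m + 1) => z i) h
  exact ((h1.norm ℝ h0).inv fun y => norm_ne_zero_iff.2 (h0 y)).smul h1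

theorem sphere_subset_facets (m : ℕ) :
    sphere (0 : En (m + 1)) 1 ⊆ ⋃ i : Fin (m + 1), (facetToSphere i 1 '' closedBall 0 1 ∪
      facetToSphere i (-1) '' closedBall 0 1) := by
  intro x hx
  have hx1 : ‖x‖ = 1 := by simpa using hx
  obtain ⟨i, -, hi⟩ := Finset.exists_max_image Finset.univ (fun i => |x i|) ⟨0, Finset.mem_univ _⟩
  have hi0 : 0 < |x i| := by
    by_contra h
    have : x = 0 := by
      ext j
      have := hi j (Finset.mem_univ _)
      have h2 := abs_nonneg (x j)
      simpa using (abs_eq_zero.1 (by linarith) : x j = 0)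
    simp [this] at hx1
  have key : ∀ s : ℝ, s * |x i| = x i →
      facetToSphere i s (fun k => x (i.succAbove k) / |x i|) = x := by
    intro s hs
    have h : (WithLp.toLp 2 (i.insertNth s (fun k => x (i.succAbove k) / |x i|) :
        Fin (m + 1) → ℝ) : En (m + 1)) = (|x i|)⁻¹ • x := by
      ext j
      refine Fin.succAboveCases i ?_ (fun k => ?_) j
      · simp; field_simp; exact hs
      · simp; field_simp
    rw [facetToSphere, h, norm_smul, hx1]
    simp [smul_smul, hi0.ne']
  have hb : (fun k => x (i.succAbove k) / |x i|) ∈ closedBall (0 : Fin m → ℝ) 1 := by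
    rw [mem_closedBall_zero_iff, pi_norm_le_iff_of_nonneg zero_le_one]
    intro k
    rw [Real.norm_eq_abs, abs_div, abs_abs, div_le_one hi0]
    exact hi _ (Finset.mem_univ _)
  refine Set.mem_iUnion.2 ⟨i, ?_⟩
  rcases le_total 0 (x i) with h | h
  · exact Or.inl ⟨_, hb, key 1 (by rw [abs_of_nonneg h]; ring)⟩
  · exact Or.inr ⟨_, hb, key (-1) (by rw [abs_of_nonpos h]; ring)⟩

theorem hausdorffMeasure_facetToSphere_lt_top {m : ℕ} (i : Fin (m + 1)) {s : ℝ} (hs : s ≠ 0) :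
    Measure.hausdorffMeasure (m : ℝ) (facetToSphere i s '' closedBall 0 1) < ⊤ := by
  obtain ⟨K, hK⟩ := (contDiff_facetToSphere i hs).contDiffOn.exists_lipschitzOnWith one_ne_zero
    (convex_closedBall (0 : Fin m → ℝ) 1) (isCompact_closedBall 0 1)
  refine (hK.hausdorffMeasure_image_le (Nat.cast_nonneg m)).trans_lt ?_
  refine ENNReal.mul_lt_top (by simp) ?_
  have := hausdorffMeasure_pi_real (ι := Fin m)
  rw [Fintype.card_fin] at this
  rw [this]
  exact measure_closedBall_lt_top

theorem isFiniteMeasure_sphMeas {n : ℕ} (hn : 2 ≤ n) : IsFiniteMeasure (sphMeas n) := by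
  obtain ⟨m, rfl⟩ : ∃ m, n = m + 1 := ⟨n - 1, by omega⟩
  refine ⟨?_⟩
  rw [sphMeas, Measure.restrict_apply_univ]
  have : ((m + 1 : ℕ) : ℝ) - 1 = m := by push_cast; ring
  rw [this]
  refine (measure_mono (sphere_subset_facets m)).trans_lt ?_
  refine (measure_iUnion_le _).trans_lt ?_
  rw [tsum_fintype]
  refine ENNReal.sum_lt_top.2 fun i _ => (measure_union_le _ _).trans_lt ?_
  exact ENNReal.add_lt_top.2 ⟨hausdorffMeasure_facetToSphere_lt_top i one_ne_zero,
    hausdorffMeasure_facetToSphere_lt_top i (by norm_num)⟩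

theorem sphMeas_ne_zero {n : ℕ} (hn : 2 ≤ n) : sphMeas n ≠ 0 := by
  obtain ⟨m, rfl⟩ : ∃ m, n = m + 1 := ⟨n - 1, by omega⟩
  intro h0
  have h : Measure.hausdorffMeasure (m : ℝ) (sphere (0 : En (m + 1)) 1) = 0 := by
    have : ((m + 1 : ℕ) : ℝ) - 1 = m := by push_cast; ring
    rw [← this, ← Measure.restrict_apply_univ]
    exact Measure.measure_univ_eq_zero.2 h0
  let π : En (m + 1) → (Fin m → ℝ) := fun x k => x k.succ
  have hπ : LipschitzWith 1 π := by
    refine LipschitzWith.of_dist_le_mul fun x y => ?_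
    rw [NNReal.coe_one, one_mul, dist_pi_le_iff dist_nonneg]
    intro k
    rw [dist_eq_norm x y]
    simpa [Real.dist_eq] using PiLp.norm_apply_le (x - y) k.succ
  have h1 := hπ.hausdorffMeasure_image_le (Nat.cast_nonneg m) (sphere (0 : En (m + 1)) 1)
  rw [h, mul_zero] at h1
  have hvol := hausdorffMeasure_pi_real (ι := Fin m)
  rw [Fintype.card_fin] at hvol
  rw [hvol] at h1
  have hε : (0 : ℝ) < 1 / (m + 1) := by positivity
  refine (measure_ball_pos volume (0 : Fin m → ℝ) hε).ne' (le_antisymm ?_ zero_le)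
  refine (measure_mono ?_).trans h1
  intro y hy
  have hy' : ∀ k, |y k| < 1 / (m + 1) := by
    intro k
    exact (norm_le_pi_norm y k).trans_lt (by simpa using hy)
  have hsum : ∑ k, y k ^ 2 ≤ 1 := by
    calc ∑ k, y k ^ 2 ≤ ∑ _k : Fin m, (1 / (m + 1) : ℝ) := by
          refine Finset.sum_le_sum fun k _ => ?_
          have h1 : (1 : ℝ) / (m + 1) ≤ 1 := by
            rw [div_le_one (by positivity)]; linarith [(Nat.cast_nonneg m : (0 : ℝ) ≤ m)]
          rw [← sq_abs]
          nlinarith [hy' k, abs_nonneg (y k)]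
      _ ≤ 1 := by
          rw [Finset.sum_const, Finset.card_univ, Fintype.card_fin, nsmul_eq_mul, mul_one_div,
            div_le_one (by positivity)]
          linarith
  refine ⟨WithLp.toLp 2 (Fin.cons (√(1 - ∑ k, y k ^ 2)) y : Fin (m + 1) → ℝ), ?_, ?_⟩
  · rw [mem_sphere_zero_iff_norm, EuclideanSpace.norm_eq, Real.sqrt_eq_one, Fin.sum_univ_succ]
    simp [Real.sq_sqrt (sub_nonneg.2 hsum)]
  · ext k
    simp [π]

/-- The Hausdorff surface measure is a positive finite multiple of the polar one. -/
theorem exists_sphMeas_eq_smul {n : ℕ} (hn : 2 ≤ n) :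
    ∃ c : ENNReal, c ≠ 0 ∧ c ≠ ⊤ ∧ sphMeas n = c • polarSphMeas n := by
  have := isFiniteMeasure_sphMeas hn
  have hs : (sphMeas n + polarSphMeas n) (sphere (0 : En n) 1)ᶜ = 0 := by
    simp [sphMeas_compl_sphere, polarSphMeas_compl_sphere]
  have hu : ∀ x ∈ sphere (0 : En n) 1, ∀ y ∈ sphere (0 : En n) 1, ∀ r,
      (sphMeas n + polarSphMeas n) (closedBall x r) =
        (sphMeas n + polarSphMeas n) (closedBall y r) := fun x hx y hy r => by
    simp [sphMeas_closedBall hx hy, polarSphMeas_closedBall hx hy]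
  obtain ⟨a, ha⟩ := exists_eq_smul_of_uniform (sphMeas n) _
    (Measure.AbsolutelyContinuous.rfl.add_right _) hs
    (fun x hx y hy r => sphMeas_closedBall hx hy r) hu
  obtain ⟨b, hb⟩ := exists_eq_smul_of_uniform (polarSphMeas n) (sphMeas n + polarSphMeas n)
    (by rw [add_comm]; exact Measure.AbsolutelyContinuous.rfl.add_right _) hs
    (fun x hx y hy r => polarSphMeas_closedBall hx hy r) hu
  have htop : ∀ (c : ENNReal) (ν : Measure (En n)) [IsFiniteMeasure ν],
      ν ≠ 0 → ν = c • (sphMeas n + polarSphMeas n) → c ≠ 0 ∧ c ≠ ⊤ := by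
    intro c ν _ hν h
    refine ⟨fun hc => hν (by rw [h, hc, zero_smul]), fun hc => ?_⟩
    have h1 : ν Set.univ = c * (sphMeas n + polarSphMeas n) Set.univ := by
      conv_lhs => rw [h]
      simp [mul_add]
    have h2 : (sphMeas n + polarSphMeas n) Set.univ ≠ 0 := by
      rw [Ne, Measure.measure_univ_eq_zero]
      intro h3
      exact hν (by rw [h, h3, smul_zero])
    rw [hc, ENNReal.top_mul h2] at h1
    exact measure_ne_top ν _ h1
  obtain ⟨ha0, ha1⟩ := htop a _ (sphMeas_ne_zero hn) ha
  obtain ⟨hb0, hb1⟩ := htop b _ (polarSphMeas_ne_zero hn) hb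
  refine ⟨a * b⁻¹, mul_ne_zero ha0 (ENNReal.inv_ne_zero.2 hb1),
    ENNReal.mul_ne_top ha1 (ENNReal.inv_ne_top.2 hb0), ?_⟩
  conv_rhs => rw [hb]
  rw [smul_smul, mul_assoc, ENNReal.inv_mul_cancel hb0 hb1, mul_one]
  exact ha

theorem integral_eq_integral_polarSphMeas {n : ℕ} (hn : 0 < n) {f : En n → ℝ}
    (hf : Integrable f) :
    ∫ x, f x = ∫ ω, (∫ r in Set.Ioi (0 : ℝ), r ^ (n - 1) * f (r • ω)) ∂(polarSphMeas n) := by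
  have : Nonempty (Fin n) := ⟨⟨0, hn⟩⟩
  have hmp := (volume : Measure (En n)).measurePreserving_homeomorphUnitSphereProd
  have hemb := (homeomorphUnitSphereProd (En n)).measurableEmbedding
  have h1 : ∫ x, f x = ∫ x : ({0}ᶜ : Set (En n)), f x ∂(Measure.comap Subtype.val volume) := by
    rw [integral_subtype_comap (measurableSet_singleton _).compl f, restrict_compl_singleton]
  have hi : Integrable (fun x : ({0}ᶜ : Set (En n)) => f x) (Measure.comap Subtype.val volume) := by
    have := integrableOn_iff_comap_subtypeVal (μ := (volume : Measure (En n))) (f := f)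
      (measurableSet_singleton (0 : En n)).compl
    exact this.1 hf.integrableOn
  have heq : ∀ x : ({0}ᶜ : Set (En n)), f x =
      (fun p : sphere (0 : En n) 1 × Set.Ioi (0 : ℝ) => f ((p.2 : ℝ) • (p.1 : En n)))
        (homeomorphUnitSphereProd (En n) x) := by
    intro x
    have h0 : ‖(x : En n)‖ ≠ 0 := norm_ne_zero_iff.2 x.2
    simp [smul_smul, h0]
  have h2 := hmp.integral_comp hemb
    (fun p : sphere (0 : En n) 1 × Set.Ioi (0 : ℝ) => f ((p.2 : ℝ) • (p.1 : En n)))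
  have hi2 := (hmp.integrable_comp_emb hemb
    (g := fun p : sphere (0 : En n) 1 × Set.Ioi (0 : ℝ) => f ((p.2 : ℝ) • (p.1 : En n)))).1
    (by simpa only [Function.comp_def, ← heq] using hi)
  rw [h1, integral_congr_ae (ae_of_all _ heq), h2, integral_prod _ hi2, polarSphMeas,
    (MeasurableEmbedding.subtype_coe isClosed_sphere.measurableSet).integral_map]
  refine integral_congr_ae (ae_of_all _ fun ω => ?_)
  simp only [Measure.volumeIoiPow, ENNReal.ofReal]
  rw [integral_withDensity_eq_integral_smul,
    integral_subtype_comap measurableSet_Ioi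
      fun a : ℝ => Real.toNNReal (a ^ (Module.finrank ℝ (En n) - 1)) • f (a • (ω : En n))]
  · refine setIntegral_congr_fun measurableSet_Ioi fun x hx => ?_
    simp only [NNReal.smul_def, finrank_euclideanSpace_fin, smul_eq_mul]
    rw [Real.coe_toNNReal _ (pow_nonneg (le_of_lt hx) _)]
  · exact (measurable_subtype_coe.pow_const _).real_toNNReal

theorem continuous_psiM {n : ℕ} (C : Matrix (Fin n) (Fin n) ℝ) : Continuous (psiM C) := by
  unfold psiM; fun_prop

theorem psiM_smul {n : ℕ} (C : Matrix (Fin n) (Fin n) ℝ) (r : ℝ) (x : En n) :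
    psiM C (r • x) = r ^ 2 * psiM C x := by
  simp only [psiM, PiLp.smul_apply, smul_eq_mul, Finset.mul_sum]
  refine Finset.sum_congr rfl fun i _ => Finset.sum_congr rfl fun j _ => by ring

theorem hasDerivAt_radial_div_sq {n : ℕ} {w : En n → ℝ} {g ω : En n} {r : ℝ} (hr : r ≠ 0)
    (hw : HasGradientAt w g (r • ω)) :
    HasDerivAt (fun ρ : ℝ => w (ρ • ω) / ρ ^ 2)
      ((r ^ 3)⁻¹ * (inner ℝ (r • ω) g - 2 * w (r • ω))) r := by
  have h1 : HasDerivAt (fun ρ : ℝ => ρ • ω) ω r := by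
    simpa using (hasDerivAt_id r).smul_const ω
  have h2 := hw.hasFDerivAt.comp_hasDerivAt r h1
  refine (h2.div (hasDerivAt_pow 2 r) (pow_ne_zero 2 hr)).congr_deriv ?_
  simp only [InnerProductSpace.toDual_apply_apply, Function.comp_apply, inner_smul_left,
    real_inner_comm g ω]
  simp
  field_simp

/-- The open annulus between two spheres centred at the origin. -/
def annulus (n : ℕ) (r₁ r₂ : ℝ) : Set (En n) := {x | r₁ < ‖x‖ ∧ ‖x‖ < r₂}

theorem measurableSet_annulus (n : ℕ) (r₁ r₂ : ℝ) : MeasurableSet (annulus n r₁ r₂) :=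
  ((isOpen_lt continuous_const continuous_norm).inter
    (isOpen_lt continuous_norm continuous_const)).measurableSet

theorem setIntegral_annulus_eq {n : ℕ} (hn : 2 ≤ n) {w : En n → ℝ} {G : En n → En n}
    (hw : ∀ x ∈ ball (0 : En n) 1, HasGradientAt w (G x) x)
    (hG : ContinuousOn G (ball (0 : En n) 1)) {r₁ r₂ : ℝ} (h0 : 0 < r₁) (h12 : r₁ ≤ r₂)
    (h2 : r₂ < 1) (C : Matrix (Fin n) (Fin n) ℝ) :
    ∫ x in annulus n r₁ r₂, (‖x‖ ^ (n + 4))⁻¹ * (psiM C x * (inner ℝ x (G x) - 2 * w x)) =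
      ∫ x, (w (r₂ • x) / r₂ ^ 2 - w (r₁ • x) / r₁ ^ 2) * psiM C x ∂(polarSphMeas n) := by
  have hwc : ContinuousOn w (ball (0 : En n) 1) := fun x hx =>
    (hw x hx).hasFDerivAt.continuousAt.continuousWithinAt
  set f : En n → ℝ := fun x =>
    (‖x‖ ^ (n + 4))⁻¹ * (psiM C x * (inner ℝ x (G x) - 2 * w x)) with hf
  have hcpt : IsCompact (closedBall (0 : En n) r₂ \ ball 0 r₁) :=
    (isCompact_closedBall 0 r₂).diff isOpen_ball
  have hsub : closedBall (0 : En n) r₂ \ ball 0 r₁ ⊆ ball 0 1 :=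
    fun x hx => closedBall_subset_ball h2 hx.1
  have hcont : ContinuousOn f (closedBall (0 : En n) r₂ \ ball 0 r₁) := by
    refine ContinuousOn.mul (ContinuousOn.inv₀ (by fun_prop) ?_)
      ((continuous_psiM C).continuousOn.mul
      ((continuousOn_id.inner (hG.mono hsub)).sub (continuousOn_const.mul (hwc.mono hsub))))
    intro x hx
    have : r₁ ≤ ‖x‖ := by simpa using hx.2
    exact pow_ne_zero _ (by linarith)
  have hf_int : Integrable ((annulus n r₁ r₂).indicator f) := by
    rw [integrable_indicator_iff (measurableSet_annulus n r₁ r₂)]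
    refine (hcont.integrableOn_compact hcpt).mono_set fun x hx => ⟨?_, ?_⟩
    · simpa using hx.2.le
    · simpa using hx.1.le
  rw [← integral_indicator (measurableSet_annulus n r₁ r₂), 
    integral_eq_integral_polarSphMeas (by omega) hf_int]
  refine integral_congr_ae ?_
  filter_upwards [mem_ae_iff.2 (polarSphMeas_compl_sphere n)] with ω hω
  have hω1 : ‖ω‖ = 1 := by simpa using hω
  have hball : ∀ r ∈ Set.Icc r₁ r₂, r • ω ∈ ball (0 : En n) 1 := fun r hr => by
    rw [mem_ball_zero_iff, norm_smul, hω1, mul_one, Real.norm_eq_abs,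
      abs_of_pos (h0.trans_le hr.1)]
    exact hr.2.trans_lt h2
  have hfun : ∀ r ∈ Set.Ioi (0 : ℝ), r ^ (n - 1) * (annulus n r₁ r₂).indicator f (r • ω) =
      (Set.Ioo r₁ r₂).indicator
        (fun r => ((r ^ 3)⁻¹ * (inner ℝ (r • ω) (G (r • ω)) - 2 * w (r • ω))) * psiM C ω) r := by
    intro r hr
    have hr0 : (0 : ℝ) < r := hr
    have hnorm : ‖r • ω‖ = r := by
      rw [norm_smul, hω1, mul_one, Real.norm_eq_abs, abs_of_pos hr0]
    by_cases hmem : r ∈ Set.Ioo r₁ r₂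
    · have hm : r • ω ∈ annulus n r₁ r₂ := by
        simpa [annulus, hnorm] using hmem
      rw [Set.indicator_of_mem hm, Set.indicator_of_mem hmem, hf]
      simp only [hnorm, psiM_smul]
      obtain ⟨m, rfl⟩ : ∃ m, n = m + 1 := ⟨n - 1, by omega⟩
      simp only [Nat.add_sub_cancel]
      field_simp
      ring
    · have hm : r • ω ∉ annulus n r₁ r₂ := by
        simpa [annulus, hnorm] using hmem
      rw [Set.indicator_of_notMem hm, Set.indicator_of_notMem hmem, mul_zero]
  have hIoo : Set.Ioo r₁ r₂ ⊆ Set.Ioi 0 := fun r hr => h0.trans hr.1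
  rw [setIntegral_congr_fun measurableSet_Ioi hfun, setIntegral_indicator measurableSet_Ioo,
    Set.inter_eq_self_of_subset_right hIoo, ← integral_Ioc_eq_integral_Ioo,
    ← intervalIntegral.integral_of_le h12, intervalIntegral.integral_mul_const]
  congr 1
  have hline : ContinuousOn (fun r : ℝ => r • ω) (Set.Icc r₁ r₂) := by fun_prop
  refine intervalIntegral.integral_eq_sub_of_hasDerivAt (f := fun r : ℝ => w (r • ω) / r ^ 2)
    (fun r hr => ?_) ?_
  · rw [Set.uIcc_of_le h12] at hr
    exact hasDerivAt_radial_div_sq (h0.trans_le hr.1).ne' (hw _ (hball r hr))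
  · refine ContinuousOn.intervalIntegrable ?_
    rw [Set.uIcc_of_le h12]
    refine ContinuousOn.mul (ContinuousOn.inv₀ (by fun_prop) ?_)
      ((hline.inner (hG.comp hline hball)).sub (continuousOn_const.mul (hwc.comp hline hball)))
    intro r hr
    exact pow_ne_zero _ (h0.trans_le hr.1).ne'

section RadialCutoff

/-- The radial cutoff which vanishes for `r₂ ≤ ‖x‖`, is constant for `‖x‖ ≤ r₁`, and has radial
derivative `-‖x‖ ^ (-(n + 3))` in between. -/
def radialCutoff (n : ℕ) (r₁ r₂ : ℝ) (x : En n) : ℝ :=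
  (((max r₁ (min ‖x‖ r₂)) ^ (n + 2))⁻¹ - (r₂ ^ (n + 2))⁻¹) / (n + 2)

variable {n : ℕ} {r₁ r₂ : ℝ}

theorem exists_lipschitzWith_radialCutoff (h0 : 0 < r₁) (h12 : r₁ ≤ r₂) :
    ∃ K, LipschitzWith K (radialCutoff n r₁ r₂) := by
  have hφ : ContDiffOn ℝ 1 (fun r : ℝ => ((r ^ (n + 2))⁻¹ - (r₂ ^ (n + 2))⁻¹) / (n + 2))
      (Set.Icc r₁ r₂) := by
    refine ContDiffOn.div_const (ContDiffOn.sub (ContDiffOn.inv (by fun_prop) ?_)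
      contDiffOn_const) _
    intro r hr
    exact pow_ne_zero _ (h0.trans_le hr.1).ne'
  obtain ⟨K, hK⟩ := hφ.exists_lipschitzOnWith one_ne_zero (convex_Icc r₁ r₂) isCompact_Icc
  have hc : LipschitzWith 1 (fun x : En n => max r₁ (min ‖x‖ r₂)) :=
    (lipschitzWith_one_norm.min_const r₂).const_max r₁
  refine ⟨K * 1, ?_⟩
  rw [← lipschitzOnWith_univ]
  refine hK.comp (hc.lipschitzOnWith) fun x _ => ⟨le_max_left _ _, max_le h12 (min_le_right _ _)⟩

theorem radialCutoff_eq_zero (h12 : r₁ ≤ r₂) {x : En n} (hx : r₂ ≤ ‖x‖) :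
    radialCutoff n r₁ r₂ x = 0 := by
  simp [radialCutoff, min_eq_right hx, max_eq_right h12]

theorem radialCutoff_nonneg (h0 : 0 < r₁) (h12 : r₁ ≤ r₂) (x : En n) :
    0 ≤ radialCutoff n r₁ r₂ x := by
  have h : max r₁ (min ‖x‖ r₂) ≤ r₂ := max_le h12 (min_le_right _ _)
  have h1 : 0 < max r₁ (min ‖x‖ r₂) := h0.trans_le (le_max_left _ _)
  refine div_nonneg (sub_nonneg.2 ?_) (by positivity)
  gcongr

theorem hasCompactSupport_radialCutoff (h12 : r₁ ≤ r₂) :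
    HasCompactSupport (radialCutoff n r₁ r₂) := by
  refine HasCompactSupport.of_support_subset_isCompact (isCompact_closedBall 0 r₂) fun x hx => ?_
  rw [mem_closedBall_zero_iff]
  by_contra h
  exact hx (radialCutoff_eq_zero h12 (not_le.1 h).le)

theorem lineDeriv_radialCutoff_of_lt {x : En n} (hx : ‖x‖ < r₁) (v : En n) :
    lineDeriv ℝ (radialCutoff n r₁ r₂) x v = 0 := by
  have h : radialCutoff n r₁ r₂ =ᶠ[𝓝 x]
      fun _ => ((r₁ ^ (n + 2))⁻¹ - (r₂ ^ (n + 2))⁻¹) / (n + 2) := by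
    filter_upwards [continuous_norm.continuousAt.eventually (gt_mem_nhds hx)] with y hy
    have : min ‖y‖ r₂ ≤ r₁ := (min_le_left _ _).trans hy.le
    simp [radialCutoff, max_eq_left this]
  rw [h.lineDeriv_eq]
  simp [lineDeriv]

theorem lineDeriv_radialCutoff_of_gt (h12 : r₁ ≤ r₂) {x : En n} (hx : r₂ < ‖x‖) (v : En n) :
    lineDeriv ℝ (radialCutoff n r₁ r₂) x v = 0 := by
  have h : radialCutoff n r₁ r₂ =ᶠ[𝓝 x] fun _ => 0 := by
    filter_upwards [continuous_norm.continuousAt.eventually (lt_mem_nhds hx)] with y hy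
    exact radialCutoff_eq_zero h12 hy.le
  rw [h.lineDeriv_eq]
  simp [lineDeriv]

theorem lineDeriv_radialCutoff_of_mem (h0 : 0 < r₁) {x : En n}
    (hx : x ∈ annulus n r₁ r₂) (v : En n) :
    lineDeriv ℝ (radialCutoff n r₁ r₂) x v = -((‖x‖ ^ (n + 4))⁻¹ * inner ℝ x v) := by
  have h : radialCutoff n r₁ r₂ =ᶠ[𝓝 x]
      fun y => (((‖y‖ ^ 2).sqrt ^ (n + 2))⁻¹ - (r₂ ^ (n + 2))⁻¹) / (n + 2) := by
    filter_upwards [continuous_norm.continuousAt.eventually (lt_mem_nhds hx.1),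
      continuous_norm.continuousAt.eventually (gt_mem_nhds hx.2)] with y hy hy2
    rw [radialCutoff, min_eq_left hy2.le, max_eq_right hy.le, Real.sqrt_sq (norm_nonneg _)]
  rw [h.lineDeriv_eq]
  have hx0 : 0 < ‖x‖ := h0.trans hx.1
  have hline : HasDerivAt (fun t : ℝ => x + t • v) v 0 := by
    simpa using ((hasDerivAt_id (0 : ℝ)).smul_const v).const_add x
  have hsq := (hline.norm_sq.sqrt (by simpa using hx0.ne')).pow (n + 2)
  have hfin := ((hsq.inv (by simpa using hx0.ne')).sub_const (r₂ ^ (n + 2))⁻¹).div_const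
    ((n : ℝ) + 2)
  refine hfin.deriv.trans ?_
  simp only [zero_smul, add_zero, Real.sqrt_sq hx0.le, Pi.pow_apply]
  have hn2 : (n : ℝ) + 2 ≠ 0 := by positivity
  push_cast
  field_simp
  ring

theorem radialCutoff_eq_integral {t₁ t₂ : ℝ} (h : t₁ ≤ t₂) (x : En n) :
    radialCutoff n (Real.exp (-t₂)) (Real.exp (-t₁)) x =
      ∫ s in Set.Ioo t₁ t₂, (Set.Ioi ‖x‖).indicator (fun _ => Real.exp ((n + 2) * s))
        (Real.exp (-s)) := by
  set ρ := max (Real.exp (-t₂)) (min ‖x‖ (Real.exp (-t₁))) with hρ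
  have hρ0 : 0 < ρ := (Real.exp_pos _).trans_le (le_max_left _ _)
  set b := -Real.log ρ with hb
  have hρb : ρ = Real.exp (-b) := by rw [hb, neg_neg, Real.exp_log hρ0]
  have hb1 : t₁ ≤ b := by
    have : ρ ≤ Real.exp (-t₁) := max_le (by gcongr) (min_le_right _ _)
    rw [hρb, Real.exp_le_exp] at this
    linarith
  have hb2 : b ≤ t₂ := by
    have : Real.exp (-t₂) ≤ ρ := le_max_left _ _
    rw [hρb, Real.exp_le_exp] at this
    linarith
  have hiff : ∀ s ∈ Set.Ioo t₁ t₂, (‖x‖ < Real.exp (-s) ↔ s < b) := by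
    intro s hs
    have e1 : Real.exp (-t₂) < Real.exp (-s) := Real.exp_lt_exp.2 (by linarith [hs.2])
    have e2 : Real.exp (-s) < Real.exp (-t₁) := Real.exp_lt_exp.2 (by linarith [hs.1])
    have : s < b ↔ ρ < Real.exp (-s) := by
      rw [hρb, Real.exp_lt_exp]; constructor <;> intro <;> linarith
    rw [this, hρ, max_lt_iff, min_lt_iff]
    constructor
    · exact fun h => ⟨e1, Or.inl h⟩
    · rintro ⟨-, h | h⟩
      · exact h
      · exact absurd h e2.not_gt
  have hcongr : ∀ s ∈ Set.Ioo t₁ t₂,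
      (Set.Ioi ‖x‖).indicator (fun _ => Real.exp ((n + 2) * s)) (Real.exp (-s)) =
        (Set.Iio b).indicator (fun s => Real.exp ((n + 2) * s)) s := by
    intro s hs
    have := hiff s hs
    by_cases hsb : s < b <;> simp [Set.indicator, this, hsb]
  have hinter : Set.Ioo t₁ t₂ ∩ Set.Iio b = Set.Ioo t₁ b := by
    ext s
    simp only [Set.mem_inter_iff, Set.mem_Ioo, Set.mem_Iio]
    exact ⟨fun h => ⟨h.1.1, h.2⟩, fun h => ⟨⟨h.1, h.2.trans_le hb2⟩, h.2⟩⟩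
  have hn2 : (n : ℝ) + 2 ≠ 0 := by positivity
  rw [setIntegral_congr_fun measurableSet_Ioo hcongr, setIntegral_indicator measurableSet_Iio,
    hinter, ← integral_Ioc_eq_integral_Ioo, ← intervalIntegral.integral_of_le hb1,
    intervalIntegral.integral_comp_mul_left (fun s => Real.exp s) hn2, integral_exp, radialCutoff,
    ← hρ, hρb]
  simp only [← Real.exp_nat_mul, ← Real.exp_neg]
  push_cast
  ring_nf

end RadialCutoff

theorem LipschitzOnWith.exists_mul_unitBall {n : ℕ} {f g : En n → ℝ}
    (hf : ∃ K, LipschitzOnWith K f (ball (0 : En n) 1))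
    (hg : ∃ K, LipschitzOnWith K g (ball (0 : En n) 1)) :
    ∃ K, LipschitzOnWith K (fun x => f x * g x) (ball (0 : En n) 1) := by
  obtain ⟨K, hK⟩ := hf
  obtain ⟨L, hL⟩ := hg
  have bound : ∀ (h : En n → ℝ) (M : NNReal), LipschitzOnWith M h (ball (0 : En n) 1) →
      ∀ x ∈ ball (0 : En n) 1, |h x| ≤ |h 0| + M := by
    intro h M hM x hx
    have h1 := hM.dist_le_mul x hx 0 (mem_ball_self one_pos)
    rw [Real.dist_eq, dist_zero_right] at h1
    have h2 : (M : ℝ) * ‖x‖ ≤ M := mul_le_of_le_one_right M.2 (by simpa using (mem_ball.1 hx).le)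
    have h3 := abs_sub_abs_le_abs_sub (h x) (h 0)
    linarith
  refine ⟨(Real.toNNReal (|f 0| + K)) * L + Real.toNNReal (|g 0| + L) * K,
    LipschitzOnWith.of_dist_le_mul fun x hx y hy => ?_⟩
  have hfx := bound f K hK x hx
  have hgy := bound g L hL y hy
  have h1 := hK.dist_le_mul x hx y hy
  have h2 := hL.dist_le_mul x hx y hy
  rw [Real.dist_eq] at h1 h2 ⊢
  push_cast
  rw [Real.coe_toNNReal _ (by positivity), Real.coe_toNNReal _ (by positivity)]
  calc |f x * g x - f y * g y| = |f x * (g x - g y) + g y * (f x - f y)| := by ring_nf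
    _ ≤ |f x| * |g x - g y| + |g y| * |f x - f y| := by
      rw [← abs_mul, ← abs_mul]; exact abs_add_le _ _
    _ ≤ (|f 0| + K) * (L * dist x y) + (|g 0| + L) * (K * dist x y) := by gcongr
    _ = _ := by ring

theorem ContDiff.exists_lipschitzOnWith_unitBall {n : ℕ} {f : En n → ℝ} (hf : ContDiff ℝ 1 f) :
    ∃ K, LipschitzOnWith K f (ball (0 : En n) 1) := by
  obtain ⟨K, hK⟩ := hf.contDiffOn.exists_lipschitzOnWith one_ne_zero
    (convex_closedBall (0 : En n) 1) (isCompact_closedBall 0 1)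
  exact ⟨K, hK.mono ball_subset_closedBall⟩

theorem HasGradientAt.exists_lipschitzOnWith_unitBall {n : ℕ} {w : En n → ℝ} {G : En n → En n}
    (hw : ∀ x ∈ ball (0 : En n) 1, HasGradientAt w (G x) x) {L : NNReal}
    (hG : LipschitzOnWith L G (ball (0 : En n) 1)) :
    ∃ K, LipschitzOnWith K w (ball (0 : En n) 1) := by
  refine ⟨‖G 0‖₊ + L, (convex_ball (0 : En n) 1).lipschitzOnWith_of_nnnorm_hasFDerivWithin_le
    (fun x hx => (hw x hx).hasFDerivAt.hasFDerivWithinAt) fun x hx => ?_⟩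
  rw [LinearIsometryEquiv.nnnorm_map, ← NNReal.coe_le_coe]
  push_cast
  have h1 := hG.dist_le_mul x hx 0 (mem_ball_self one_pos)
  rw [dist_eq_norm, dist_zero_right] at h1
  have h2 : (L : ℝ) * ‖x‖ ≤ L := mul_le_of_le_one_right L.2 (by simpa using (mem_ball.1 hx).le)
  have h3 := norm_sub_norm_le (G x) (G 0)
  linarith

/-- The `i`-th partial derivative of `psiM C` for symmetric `C`. -/
def psiPartial {n : ℕ} (C : Matrix (Fin n) (Fin n) ℝ) (i : Fin n) (x : En n) : ℝ :=
  ∑ j, C i j * x j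

theorem contDiff_psiM {n : ℕ} (C : Matrix (Fin n) (Fin n) ℝ) : ContDiff ℝ 1 (psiM C) := by
  unfold psiM; fun_prop

theorem contDiff_psiPartial {n : ℕ} (C : Matrix (Fin n) (Fin n) ℝ) (i : Fin n) :
    ContDiff ℝ 1 (psiPartial C i) := by
  unfold psiPartial; fun_prop

theorem sum_mul_psiPartial {n : ℕ} (C : Matrix (Fin n) (Fin n) ℝ) (x : En n) :
    ∑ i, x i * psiPartial C i x = 2 * psiM C x := by
  simp only [psiPartial, psiM, Finset.mul_sum]
  refine Finset.sum_congr rfl fun i _ => Finset.sum_congr rfl fun j _ => by ring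

theorem psiM_add_smul_single {n : ℕ} {C : Matrix (Fin n) (Fin n) ℝ} (hC : C.IsSymm) (i : Fin n)
    (x : En n) (t : ℝ) :
    psiM C (x + t • EuclideanSpace.single i (1 : ℝ)) =
      psiM C x + t * psiPartial C i x + t ^ 2 * (C i i / 2) := by
  have hsymm : ∀ k l, C k l = C l k := fun k l => (hC.apply k l).symm
  have h1 : ∀ k,
      ∑ l, C k l * (x k + t * if k = i then 1 else 0) * (x l + t * if l = i then 1 else 0) =
      ∑ l, C k l * x k * x l + t * (x k * C k i) +
        (if k = i then t * ∑ l, C k l * x l + t ^ 2 * C i i else 0) := by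
    intro k
    have : ∀ l, C k l * (x k + t * if k = i then 1 else 0) * (x l + t * if l = i then 1 else 0) =
      C k l * x k * x l + (if l = i then t * (x k * C k l) else 0) +
        (if k = i then (t * (C k l * x l) + if l = i then t ^ 2 * C k l else 0) else 0) := by
      intro l
      split_ifs <;> ring
    simp only [this, Finset.sum_add_distrib, Finset.sum_ite_eq', Finset.mem_univ, if_true]
    split_ifs with hk
    · subst hk
      simp [Finset.sum_add_distrib, Finset.mul_sum]
    · simp
  have h2 : psiM C (x + t • EuclideanSpace.single i (1 : ℝ)) = 1 / 2 * ∑ k, ∑ l,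
      C k l * (x k + t * if k = i then 1 else 0) * (x l + t * if l = i then 1 else 0) := by
    simp [psiM]
  rw [h2]
  simp only [h1, Finset.sum_add_distrib, Finset.sum_ite_eq', Finset.mem_univ, if_true,
    ← Finset.mul_sum]
  have h3 : ∑ k, x k * C k i = psiPartial C i x :=
    Finset.sum_congr rfl fun k _ => by rw [hsymm k i, mul_comm]
  rw [h3, psiM, psiPartial]
  ring

theorem hasLineDerivAt_psiM {n : ℕ} {C : Matrix (Fin n) (Fin n) ℝ} (hC : C.IsSymm) (i : Fin n)
    (x : En n) :
    HasLineDerivAt ℝ (psiM C) (psiPartial C i x) x (EuclideanSpace.single i (1 : ℝ)) := by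
  unfold HasLineDerivAt
  simp only [psiM_add_smul_single hC]
  have h1 : HasDerivAt (fun t : ℝ => psiM C x + t * psiPartial C i x + t ^ 2 * (C i i / 2))
      (1 * psiPartial C i x + (2 : ℕ) * (0 : ℝ) ^ 1 * (C i i / 2)) 0 :=
    (((hasDerivAt_id (0 : ℝ)).mul_const _).const_add _).add ((hasDerivAt_pow 2 (0 : ℝ)).mul_const _)
  simpa using h1

theorem hasLineDerivAt_psiPartial {n : ℕ} (C : Matrix (Fin n) (Fin n) ℝ) (i : Fin n) (x : En n) :
    HasLineDerivAt ℝ (psiPartial C i) (C i i) x (EuclideanSpace.single i (1 : ℝ)) := by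
  unfold HasLineDerivAt
  have h : ∀ t : ℝ, psiPartial C i (x + t • EuclideanSpace.single i (1 : ℝ)) =
      psiPartial C i x + t * C i i := by
    intro t
    simp [psiPartial, mul_add, Finset.sum_add_distrib, mul_comm]
  simp only [h]
  simpa using ((hasDerivAt_id (0 : ℝ)).mul_const (C i i)).const_add (psiPartial C i x)

/-- The `i`-th component of the field `ψ ∇w - w ∇ψ`. -/
def greenField {n : ℕ} (C : Matrix (Fin n) (Fin n) ℝ) (w : En n → ℝ) (G : En n → En n) (i : Fin n)
    (x : En n) : ℝ :=
  psiM C x * G x i - w x * psiPartial C i x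

theorem lineDeriv_greenField {n : ℕ} {C : Matrix (Fin n) (Fin n) ℝ} (hC : C.IsSymm) {w : En n → ℝ}
    {G : En n → En n} {x : En n} (hw : HasGradientAt w (G x) x) {D : En n →L[ℝ] En n}
    (hD : HasFDerivAt G D x) (i : Fin n) :
    lineDeriv ℝ (greenField C w G i) x (EuclideanSpace.single i (1 : ℝ)) =
      psiM C x * (D (EuclideanSpace.single i (1 : ℝ))) i - w x * C i i := by
  have h1 := hw.hasFDerivAt.hasLineDerivAt (EuclideanSpace.single i (1 : ℝ))
  have h2 : HasLineDerivAt ℝ (fun y => G y i) ((D (EuclideanSpace.single i (1 : ℝ))) i) x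
      (EuclideanSpace.single i (1 : ℝ)) := by
    have := ((EuclideanSpace.proj (𝕜 := ℝ) i).hasFDerivAt.comp x hD).hasLineDerivAt
      (EuclideanSpace.single i (1 : ℝ))
    exact this
  have h3 := hasLineDerivAt_psiM hC i x
  have h4 := hasLineDerivAt_psiPartial C i x
  unfold HasLineDerivAt at h1 h2 h3 h4
  have h5 := (h3.mul h2).sub (h1.mul h4)
  refine h5.deriv.trans ?_
  simp [InnerProductSpace.toDual_apply_apply, EuclideanSpace.inner_single_right]
  ring

theorem sum_lineDeriv_greenField {n : ℕ} {C : Matrix (Fin n) (Fin n) ℝ} (hC : S0 C) {w : En n → ℝ}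
    {G : En n → En n} {x : En n} (hw : HasGradientAt w (G x) x) {D : En n →L[ℝ] En n}
    (hD : HasFDerivAt G D x) :
    ∑ i, lineDeriv ℝ (greenField C w G i) x (EuclideanSpace.single i (1 : ℝ)) =
      psiM C x * LinearMap.trace ℝ (En n) (D : En n →ₗ[ℝ] En n) := by
  have htr : LinearMap.trace ℝ (En n) (D : En n →ₗ[ℝ] En n) =
      ∑ i, (D (EuclideanSpace.single i (1 : ℝ))) i := by
    rw [LinearMap.trace_eq_sum_inner _ (EuclideanSpace.basisFun (Fin n) ℝ)]
    simp [EuclideanSpace.inner_single_left]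
  have htr0 : ∑ i, C i i = 0 := hC.2
  simp only [lineDeriv_greenField hC.1 hw hD, Finset.sum_sub_distrib, ← Finset.mul_sum, htr, htr0]
  ring

theorem exists_lipschitzOnWith_greenField {n : ℕ} (C : Matrix (Fin n) (Fin n) ℝ) {w : En n → ℝ}
    {G : En n → En n} (hw : ∀ x ∈ ball (0 : En n) 1, HasGradientAt w (G x) x) {L : NNReal}
    (hG : LipschitzOnWith L G (ball (0 : En n) 1)) (i : Fin n) :
    ∃ K, LipschitzOnWith K (greenField C w G i) (ball (0 : En n) 1) := by
  have hGi : LipschitzOnWith L (fun x => G x i) (ball (0 : En n) 1) := by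
    refine LipschitzOnWith.of_dist_le_mul fun x hx y hy => ?_
    refine le_trans ?_ (hG.dist_le_mul x hx y hy)
    rw [dist_eq_norm (G x)]
    exact PiLp.norm_apply_le (G x - G y) i
  obtain ⟨K₁, h₁⟩ := LipschitzOnWith.exists_mul_unitBall
    (contDiff_psiM C).exists_lipschitzOnWith_unitBall ⟨L, hGi⟩
  obtain ⟨K₂, h₂⟩ := LipschitzOnWith.exists_mul_unitBall
    (HasGradientAt.exists_lipschitzOnWith_unitBall hw hG)
    (contDiff_psiPartial C i).exists_lipschitzOnWith_unitBall
  exact ⟨K₁ + K₂, h₁.sub h₂⟩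

theorem ae_norm_ne {n : ℕ} {r : ℝ} (hr : r ≠ 0) : ∀ᵐ x : En n, ‖x‖ ≠ r := by
  rw [ae_iff]
  have : {x : En n | ¬ ‖x‖ ≠ r} = sphere 0 r := by ext x; simp
  rw [this]
  exact Measure.addHaar_sphere_of_ne_zero _ _ hr

theorem lineDeriv_radialCutoff_ae {n : ℕ} {r₁ r₂ : ℝ} (h0 : 0 < r₁) (h12 : r₁ ≤ r₂) (i : Fin n) :
    ∀ᵐ x : En n, lineDeriv ℝ (radialCutoff n r₁ r₂) x (-EuclideanSpace.single i (1 : ℝ)) =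
      (annulus n r₁ r₂).indicator (fun x => (‖x‖ ^ (n + 4))⁻¹ * x i) x := by
  filter_upwards [ae_norm_ne (n := n) h0.ne', ae_norm_ne (n := n) (h0.trans_le h12).ne']
    with x h1 h2
  by_cases hx : x ∈ annulus n r₁ r₂
  · rw [Set.indicator_of_mem hx, lineDeriv_radialCutoff_of_mem h0 hx]
    simp [EuclideanSpace.inner_single_right]
  · rw [Set.indicator_of_notMem hx]
    rcases lt_or_gt_of_ne h1 with h | h
    · exact lineDeriv_radialCutoff_of_lt h _
    · refine lineDeriv_radialCutoff_of_gt h12 (lt_of_le_of_ne ?_ h2.symm) _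
      by_contra h'
      exact hx ⟨h, not_le.1 h'⟩

theorem integral_radialCutoff_mul_trace {n : ℕ} {C : Matrix (Fin n) (Fin n) ℝ} (hC : S0 C)
    {w : En n → ℝ} {G : En n → En n} (hw : ∀ x ∈ ball (0 : En n) 1, HasGradientAt w (G x) x)
    {L : NNReal} (hG : LipschitzOnWith L G (ball (0 : En n) 1)) {d : En n → ℝ}
    (hd : ∀ᵐ x ∂(volume.restrict (ball (0 : En n) 1)), ∃ D : En n →L[ℝ] En n,
      HasFDerivAt G D x ∧ LinearMap.trace ℝ (En n) (D : En n →ₗ[ℝ] En n) = d x)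
    {r₁ r₂ : ℝ} (h0 : 0 < r₁) (h12 : r₁ ≤ r₂) (h2 : r₂ < 1) :
    ∫ x in ball (0 : En n) 1, radialCutoff n r₁ r₂ x * (psiM C x * d x) =
      ∫ x in annulus n r₁ r₂, (‖x‖ ^ (n + 4))⁻¹ * (psiM C x * (inner ℝ x (G x) - 2 * w x)) := by
  obtain ⟨Kη, hη⟩ := exists_lipschitzWith_radialCutoff (n := n) h0 h12
  have hηc := hasCompactSupport_radialCutoff (n := n) h12
  have hηi : Integrable (radialCutoff n r₁ r₂) :=
    hη.continuous.integrable_of_hasCompactSupport hηc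
  have hext : ∀ i, ∃ (K : NNReal) (F : En n → ℝ), LipschitzWith K F ∧
      Set.EqOn (greenField C w G i) F (ball (0 : En n) 1) := by
    intro i
    obtain ⟨K, hK⟩ := exists_lipschitzOnWith_greenField C hw hG i
    obtain ⟨F, hF, hFe⟩ := hK.extend_real
    exact ⟨K, F, hF, hFe⟩
  choose K F hF hFe using hext
  have hparts := fun i => (hF i).integral_lineDeriv_mul_eq (μ := volume) hη hηc
    (EuclideanSpace.single i (1 : ℝ))
  have hl : ∀ i, Integrable (fun x => lineDeriv ℝ (F i) x (EuclideanSpace.single i (1 : ℝ)) *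
      radialCutoff n r₁ r₂ x) := by
    intro i
    refine hηi.bdd_mul (c := K i * ‖EuclideanSpace.single i (1 : ℝ)‖)
      (measurable_lineDeriv (hF i).continuous).aestronglyMeasurable (ae_of_all _ fun x => ?_)
    exact norm_lineDeriv_le_of_lipschitz ℝ (hF i)
  have hcpt : IsCompact (closedBall (0 : En n) r₂ \ ball 0 r₁) :=
    (isCompact_closedBall 0 r₂).diff isOpen_ball
  have hae : ∀ i, (fun x => lineDeriv ℝ (radialCutoff n r₁ r₂) x
      (-EuclideanSpace.single i (1 : ℝ)) * F i x) =ᵐ[volume]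
      (annulus n r₁ r₂).indicator (fun x => (‖x‖ ^ (n + 4))⁻¹ * x i * F i x) := by
    intro i
    filter_upwards [lineDeriv_radialCutoff_ae h0 h12 i] with x hx
    rw [hx]
    by_cases h : x ∈ annulus n r₁ r₂ <;> simp [h]
  have hr : ∀ i, IntegrableOn (fun x => (‖x‖ ^ (n + 4))⁻¹ * x i * F i x) (annulus n r₁ r₂) := by
    intro i
    have hcont : ContinuousOn (fun x => (‖x‖ ^ (n + 4))⁻¹ * x i * F i x)
        (closedBall (0 : En n) r₂ \ ball 0 r₁) := by
      refine ((ContinuousOn.inv₀ (by fun_prop) ?_).mul (by fun_prop)).mul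
        (hF i).continuous.continuousOn
      intro x hx
      have : r₁ ≤ ‖x‖ := by simpa using hx.2
      exact pow_ne_zero _ (by linarith)
    refine (hcont.integrableOn_compact hcpt).mono_set fun x hx => ⟨?_, ?_⟩
    · simpa using hx.2.le
    · simpa using hx.1.le
  have hlhs : ∫ x in ball (0 : En n) 1, radialCutoff n r₁ r₂ x * (psiM C x * d x) =
      ∑ i, ∫ x, lineDeriv ℝ (F i) x (EuclideanSpace.single i (1 : ℝ)) * radialCutoff n r₁ r₂ x := by
    rw [← integral_finsetSum _ fun i _ => hl i, ← integral_indicator measurableSet_ball]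
    refine integral_congr_ae ?_
    filter_upwards [(ae_restrict_iff' measurableSet_ball).1 hd] with x hx
    by_cases hxb : x ∈ ball (0 : En n) 1
    · obtain ⟨D, hD, htr⟩ := hx hxb
      rw [Set.indicator_of_mem hxb, ← Finset.sum_mul, ← htr,
        ← sum_lineDeriv_greenField hC (hw x hxb) hD, mul_comm]
      congr 1
      refine Finset.sum_congr rfl fun i _ => ?_
      have : greenField C w G i =ᶠ[𝓝 x] F i :=
        (hFe i).eventuallyEq_of_mem (isOpen_ball.mem_nhds hxb)
      exact this.lineDeriv_eq
    · rw [Set.indicator_of_notMem hxb]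
      have : r₂ ≤ ‖x‖ := h2.le.trans (by simpa using hxb)
      simp [radialCutoff_eq_zero h12 this]
  rw [hlhs, Finset.sum_congr rfl fun i _ => (hparts i).trans (integral_congr_ae (hae i))]
  simp only [integral_indicator (measurableSet_annulus n r₁ r₂)]
  rw [← integral_finsetSum _ fun i _ => hr i]
  refine setIntegral_congr_fun (measurableSet_annulus n r₁ r₂) fun x hx => ?_
  have hxb : x ∈ ball (0 : En n) 1 := by simpa using hx.2.trans h2
  have hsum : ∑ i, x i * greenField C w G i x = psiM C x * (inner ℝ x (G x) - 2 * w x) := by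
    have h1 : inner ℝ x (G x) = ∑ i, x i * G x i := by
      simp [PiLp.inner_apply, mul_comm]
    rw [h1, mul_sub, Finset.mul_sum, show psiM C x * (2 * w x) = w x * (2 * psiM C x) by ring,
      ← sum_mul_psiPartial, Finset.mul_sum, ← Finset.sum_sub_distrib]
    exact Finset.sum_congr rfl fun i _ => by rw [greenField]; ring
  simp only [← hsum, Finset.mul_sum]
  exact Finset.sum_congr rfl fun i _ => by rw [← hFe i hxb, mul_assoc]

theorem polarSphMeas_restrict_sphere (n : ℕ) :
    (polarSphMeas n).restrict (sphere (0 : En n) 1) = polarSphMeas n :=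
  Measure.restrict_eq_self_of_ae_mem (mem_ae_iff.2 (polarSphMeas_compl_sphere n))

theorem ContinuousOn.integrable_polarSphMeas {n : ℕ} {f : En n → ℝ}
    (hf : ContinuousOn f (sphere (0 : En n) 1)) : Integrable f (polarSphMeas n) := by
  have h := hf.integrableOn_compact (μ := polarSphMeas n) (isCompact_sphere 0 1)
  rwa [IntegrableOn, polarSphMeas_restrict_sphere] at h

theorem eq_zero_of_psiM_eq_zero {n : ℕ} {C : Matrix (Fin n) (Fin n) ℝ} (hC : C.IsSymm)
    (h : ∀ x ∈ sphere (0 : En n) 1, psiM C x = 0) : C = 0 := by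
  have hall : ∀ x, psiM C x = 0 := by
    intro x
    rcases eq_or_ne x 0 with rfl | hx
    · simp [psiM]
    · have h0 : ‖x‖ ≠ 0 := norm_ne_zero_iff.2 hx
      have h1 := h (‖x‖⁻¹ • x) (by simp [norm_smul, h0])
      rw [psiM_smul] at h1
      simpa [h0] using h1
  ext i j
  have h1 := psiM_add_smul_single hC i (EuclideanSpace.single j (1 : ℝ)) 1
  have h2 := psiM_add_smul_single hC i (EuclideanSpace.single j (1 : ℝ)) (-1)
  rw [hall, hall] at h1 h2
  have h3 : psiPartial C i (EuclideanSpace.single j (1 : ℝ)) = C i j := by simp [psiPartial]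
  rw [h3] at h1 h2
  simp only [Matrix.zero_apply]
  linarith

theorem integral_psiM_sq_pos {n : ℕ} {C : Matrix (Fin n) (Fin n) ℝ} (hC : C.IsSymm) (h0 : C ≠ 0) :
    0 < ∫ x, psiM C x ^ 2 ∂(polarSphMeas n) := by
  have hcont : Continuous fun x : En n => psiM C x ^ 2 := (continuous_psiM C).pow 2
  refine lt_of_le_of_ne (integral_nonneg fun x => sq_nonneg _) fun h => h0 ?_
  have hae := (integral_eq_zero_iff_of_nonneg (fun x => sq_nonneg _)
    hcont.continuousOn.integrable_polarSphMeas).1 h.symm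
  rw [polarSphMeas, Filter.EventuallyEq,
    (MeasurableEmbedding.subtype_coe isClosed_sphere.measurableSet).ae_map_iff] at hae
  have heq : (fun x : sphere (0 : En n) 1 => psiM C x ^ 2) = fun _ => 0 :=
    (Continuous.ae_eq_iff_eq (volume : Measure (En n)).toSphere
      (hcont.comp continuous_subtype_val) continuous_const).1 hae
  refine eq_zero_of_psiM_eq_zero hC fun x hx => ?_
  simpa using congrFun heq ⟨x, hx⟩

theorem frob_smul {n : ℕ} (a : ℝ) (C : Matrix (Fin n) (Fin n) ℝ) :
    frob (a • C) = |a| * frob C := by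
  simp only [frob, Matrix.smul_apply, smul_eq_mul, mul_pow, ← Finset.mul_sum]
  rw [Real.sqrt_mul (sq_nonneg a), Real.sqrt_sq_eq_abs]

theorem frob_sq {n : ℕ} (C : Matrix (Fin n) (Fin n) ℝ) : frob C ^ 2 = ∑ i, ∑ j, C i j ^ 2 :=
  Real.sq_sqrt (Finset.sum_nonneg fun _ _ => Finset.sum_nonneg fun _ _ => sq_nonneg _)

theorem abs_apply_le_frob {n : ℕ} (C : Matrix (Fin n) (Fin n) ℝ) (i j : Fin n) :
    |C i j| ≤ frob C := by
  refine abs_le_of_sq_le_sq (b := frob C) ?_ (Real.sqrt_nonneg _)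
  rw [frob_sq]
  calc C i j ^ 2 ≤ ∑ j, C i j ^ 2 :=
        Finset.single_le_sum (f := fun j => C i j ^ 2) (fun _ _ => sq_nonneg _) (Finset.mem_univ j)
    _ ≤ ∑ i, ∑ j, C i j ^ 2 :=
        Finset.single_le_sum (f := fun i => ∑ j, C i j ^ 2)
          (fun _ _ => Finset.sum_nonneg fun _ _ => sq_nonneg _) (Finset.mem_univ i)

theorem psiM_smul_matrix {n : ℕ} (a : ℝ) (C : Matrix (Fin n) (Fin n) ℝ) (x : En n) :
    psiM (a • C) x = a * psiM C x := by
  simp only [psiM, Matrix.smul_apply, smul_eq_mul, Finset.mul_sum]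
  refine Finset.sum_congr rfl fun i _ => Finset.sum_congr rfl fun j _ => by ring

theorem psiM_sub_matrix {n : ℕ} (A C : Matrix (Fin n) (Fin n) ℝ) (x : En n) :
    psiM (A - C) x = psiM A x - psiM C x := by
  simp only [psiM, Matrix.sub_apply, ← mul_sub, ← Finset.sum_sub_distrib]
  congr 1
  refine Finset.sum_congr rfl fun i _ => Finset.sum_congr rfl fun j _ => by ring

theorem exists_coercive_integral_psiM_sq (n : ℕ) :
    ∃ c : ℝ, 0 < c ∧ ∀ C : Matrix (Fin n) (Fin n) ℝ, C.IsSymm →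
      c * frob C ^ 2 ≤ ∫ x, psiM C x ^ 2 ∂(polarSphMeas n) := by
  let S : Set (Fin n → Fin n → ℝ) :=
    {C | (∀ i j, C i j = C j i) ∧ frob (Matrix.of C) = 1}
  have hS : IsCompact S := by
    refine Metric.isCompact_of_isClosed_isBounded ?_ ?_
    · have hS_eq : S = (⋂ i, ⋂ j, {C | C i j = C j i}) ∩ {C | frob (Matrix.of C) = 1} := by
        ext C
        simp [S]
      rw [hS_eq]
      refine (isClosed_iInter fun i => isClosed_iInter fun j =>
        isClosed_eq (by fun_prop) (by fun_prop)).inter (isClosed_eq ?_ continuous_const)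
      unfold frob
      simp only [Matrix.of_apply]
      fun_prop
    · refine isBounded_closedBall (x := (0 : Fin n → Fin n → ℝ)) (r := 1) |>.subset fun C hC => ?_
      rw [mem_closedBall_zero_iff, pi_norm_le_iff_of_nonneg zero_le_one]
      intro i
      rw [pi_norm_le_iff_of_nonneg zero_le_one]
      intro j
      exact (abs_apply_le_frob (Matrix.of C) i j).trans_eq hC.2
  let Q : (Fin n → Fin n → ℝ) → ℝ := fun C => ∫ x, psiM (Matrix.of C) x ^ 2 ∂(polarSphMeas n)
  have hQ : Continuous Q := by
    have h : Continuous (Function.uncurry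
        fun (C : Fin n → Fin n → ℝ) (x : En n) => psiM (Matrix.of C) x ^ 2) := by
      unfold psiM Function.uncurry
      simp only [Matrix.of_apply]
      fun_prop
    have := continuous_parametric_integral_of_continuous (μ := polarSphMeas n) h
      (isCompact_sphere (0 : En n) 1)
    simpa only [polarSphMeas_restrict_sphere] using this
  rcases S.eq_empty_or_nonempty with hemp | hne
  · refine ⟨1, one_pos, fun C hC => ?_⟩
    have hz : frob C = 0 := by
      by_contra hf
      have hpos : 0 < frob C := lt_of_le_of_ne (Real.sqrt_nonneg _) (Ne.symm hf)
      have : (frob C)⁻¹ • C ∈ S := by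
        refine ⟨fun i j => by simp [hC.apply j i], ?_⟩
        rw [show Matrix.of ((frob C)⁻¹ • C) = (frob C)⁻¹ • C from rfl, frob_smul,
          abs_of_pos (inv_pos.2 hpos), inv_mul_cancel₀ hf]
      rw [hemp] at this
      exact this
    rw [hz]
    simpa using integral_nonneg fun x => sq_nonneg (psiM C x)
  obtain ⟨C₀, hC₀, hmin⟩ := hS.exists_isMinOn hne hQ.continuousOn
  have hpos : 0 < Q C₀ := by
    refine integral_psiM_sq_pos (Matrix.IsSymm.ext fun i j => hC₀.1 j i) fun h => ?_
    have := hC₀.2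
    rw [h] at this
    simp [frob] at this
  refine ⟨Q C₀, hpos, fun C hC => ?_⟩
  by_cases hf : frob C = 0
  · rw [hf]
    simpa using integral_nonneg fun x => sq_nonneg (psiM C x)
  have hfpos : 0 < frob C := lt_of_le_of_ne (Real.sqrt_nonneg _) (Ne.symm hf)
  have hmem : (frob C)⁻¹ • C ∈ S := by
    refine ⟨fun i j => by simp [hC.apply j i], ?_⟩
    rw [show Matrix.of ((frob C)⁻¹ • C) = (frob C)⁻¹ • C from rfl, frob_smul,
      abs_of_pos (inv_pos.2 hfpos), inv_mul_cancel₀ hf]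
  have hle : Q C₀ ≤ Q ((frob C)⁻¹ • C) := hmin hmem
  have hval : Q ((frob C)⁻¹ • C) = (frob C ^ 2)⁻¹ * ∫ x, psiM C x ^ 2 ∂(polarSphMeas n) := by
    rw [← integral_const_mul]
    refine integral_congr_ae (ae_of_all _ fun x => ?_)
    change psiM ((frob C)⁻¹ • C) x ^ 2 = _
    rw [psiM_smul_matrix, mul_pow, inv_pow]
  rw [hval, ← div_eq_inv_mul, le_div_iff₀ (by positivity)] at hle
  exact hle

theorem abs_psiM_le {n : ℕ} (C : Matrix (Fin n) (Fin n) ℝ) (x : En n) :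
    |psiM C x| ≤ 1 / 2 * frob C * ‖x‖ ^ 2 := by
  have hcs := Finset.sum_mul_sq_le_sq_mul_sq (Finset.univ : Finset (Fin n × Fin n))
    (fun p => C p.1 p.2) (fun p => x p.1 * x p.2)
  have h1 : ∑ p : Fin n × Fin n, C p.1 p.2 * (x p.1 * x p.2) = ∑ i, ∑ j, C i j * x i * x j := by
    rw [Fintype.sum_prod_type]
    exact Finset.sum_congr rfl fun i _ => Finset.sum_congr rfl fun j _ => by ring
  have h2 : ∑ p : Fin n × Fin n, C p.1 p.2 ^ 2 = frob C ^ 2 := by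
    rw [frob_sq, Fintype.sum_prod_type]
  have h3 : ∑ p : Fin n × Fin n, (x p.1 * x p.2) ^ 2 = (‖x‖ ^ 2) ^ 2 := by
    rw [EuclideanSpace.real_norm_sq_eq, sq (∑ i, x i ^ 2), Finset.sum_mul_sum,
      Fintype.sum_prod_type]
    exact Finset.sum_congr rfl fun i _ => Finset.sum_congr rfl fun j _ => by ring
  rw [h1, h2, h3, ← mul_pow] at hcs
  have h4 := abs_le_of_sq_le_sq hcs (mul_nonneg (Real.sqrt_nonneg _) (sq_nonneg _))
  rw [psiM, abs_mul, abs_of_pos (by norm_num : (0 : ℝ) < 1 / 2), mul_assoc]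
  exact mul_le_mul_of_nonneg_left h4 (by norm_num)

theorem measurableSet_Lam {n : ℕ} {u : En n → ℝ}
    (hG : ContinuousOn (fun x => gradient u x) (ball (0 : En n) 1)) : MeasurableSet (Lam u) := by
  have h : Lam u = ball (0 : En n) 1 \
      (ball (0 : En n) 1 ∩ (fun x => gradient u x) ⁻¹' {0}ᶜ) := by
    ext x
    simp only [Lam, Set.mem_ofPred_eq, Set.mem_sdiff, Set.mem_inter_iff, Set.mem_preimage,
      Set.mem_compl_iff, Set.mem_singleton_iff]
    tauto
  rw [h]
  exact measurableSet_ball.diff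
    (hG.isOpen_inter_preimage isOpen_ball isOpen_compl_singleton).measurableSet

theorem LamT_inter_ball {n : ℕ} (u : En n → ℝ) (s : ℝ) :
    LamT u s ∩ ball (0 : En n) 1 = Real.exp s • (Lam u ∩ ball (0 : En n) (Real.exp (-s))) := by
  have h0 : Real.exp s ≠ 0 := (Real.exp_pos s).ne'
  rw [Set.smul_set_inter₀ h0, LamT, _root_.smul_ball h0, smul_zero, Real.norm_eq_abs, Real.abs_exp,
    ← Real.exp_add, add_neg_cancel, Real.exp_zero]

theorem Fdef_eq {n : ℕ} (u : En n → ℝ) (s : ℝ) :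
    Fdef u s = Real.exp ((n + 2) * s) *
      ∫ x in Lam u ∩ ball (0 : En n) (Real.exp (-s)), ‖x‖ ^ 2 := by
  have h := Measure.setIntegral_comp_smul_of_pos (volume : Measure (En n))
    (fun x : En n => ‖x‖ ^ 2) (Lam u ∩ ball (0 : En n) (Real.exp (-s))) (Real.exp_pos s)
  rw [← LamT_inter_ball, finrank_euclideanSpace_fin, smul_eq_mul] at h
  have h1 : ∀ x : En n, ‖Real.exp s • x‖ ^ 2 = Real.exp s ^ 2 * ‖x‖ ^ 2 := fun x => by
    rw [norm_smul, mul_pow, Real.norm_eq_abs, Real.abs_exp]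
  simp only [h1, integral_const_mul] at h
  have h2 : Real.exp ((n + 2) * s) = Real.exp s ^ n * Real.exp s ^ 2 := by
    rw [← pow_add, ← Real.exp_nat_mul]
    push_cast
    rfl
  rw [Fdef, h2, mul_assoc, h, ← mul_assoc, mul_inv_cancel₀ (by positivity), one_mul]

theorem integrableOn_norm_sq_Lam {n : ℕ} (u : En n → ℝ) :
    IntegrableOn (fun x : En n => ‖x‖ ^ 2) (Lam u) :=
  ((by fun_prop : Continuous fun x : En n => ‖x‖ ^ 2).continuousOn.integrableOn_compact
    (isCompact_closedBall (0 : En n) 1)).mono_set fun _ hx => ball_subset_closedBall hx.1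

theorem integrableOn_Fdef {n : ℕ} (u : En n → ℝ) (t₁ t₂ : ℝ) :
    IntegrableOn (Fdef u) (Set.Icc t₁ t₂) := by
  have hanti : Antitone fun s : ℝ => ∫ x in Lam u ∩ ball (0 : En n) (Real.exp (-s)), ‖x‖ ^ 2 := by
    intro s t hst
    refine setIntegral_mono_set ((integrableOn_norm_sq_Lam u).mono_set Set.inter_subset_left)
      (ae_of_all _ fun x => sq_nonneg _) (LE.le.eventuallyLE ?_)
    have : Real.exp (-t) ≤ Real.exp (-s) := Real.exp_le_exp.2 (by linarith)
    exact Set.inter_subset_inter_right _ (ball_subset_ball this)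
  have h1 : IntegrableOn (fun s : ℝ => ∫ x in Lam u ∩ ball (0 : En n) (Real.exp (-s)), ‖x‖ ^ 2)
      (Set.Icc t₁ t₂) := (hanti.antitoneOn _).integrableOn_isCompact isCompact_Icc
  have h2 := h1.continuousOn_mul (g := fun s : ℝ => Real.exp ((n + 2) * s))
    (by fun_prop) isCompact_Icc
  exact h2.congr_fun (fun s _ => (Fdef_eq u s).symm) measurableSet_Icc

theorem setIntegral_radialCutoff_mul_norm_sq {n : ℕ} {u : En n → ℝ} {t₁ t₂ : ℝ} (h : t₁ ≤ t₂) :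
    ∫ x in Lam u, radialCutoff n (Real.exp (-t₂)) (Real.exp (-t₁)) x * ‖x‖ ^ 2 =
      ∫ s in t₁..t₂, Fdef u s := by
  let A : Set (En n × ℝ) := {p | ‖p.1‖ < Real.exp (-p.2)}
  have hA : MeasurableSet A := (isOpen_lt (by fun_prop) (by fun_prop)).measurableSet
  let f : En n → ℝ → ℝ := fun x s =>
    A.indicator (fun p => ‖p.1‖ ^ 2 * Real.exp ((n + 2) * p.2)) (x, s)
  have hexp : IntegrableOn (fun s : ℝ => Real.exp ((n + 2) * s)) (Set.Ioo t₁ t₂) :=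
    ((by fun_prop : Continuous fun s : ℝ => Real.exp ((n + 2) * s)).continuousOn
      |>.integrableOn_compact isCompact_Icc).mono_set Set.Ioo_subset_Icc_self
  have hf_int : Integrable (Function.uncurry f)
      ((volume.restrict (Lam u)).prod (volume.restrict (Set.Ioo t₁ t₂))) :=
    (Integrable.mul_prod (integrableOn_norm_sq_Lam u) hexp).indicator hA
  have hleft : ∀ x, radialCutoff n (Real.exp (-t₂)) (Real.exp (-t₁)) x * ‖x‖ ^ 2 =
      ∫ s in Set.Ioo t₁ t₂, f x s := by
    intro x
    rw [radialCutoff_eq_integral h, ← integral_mul_const]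
    refine integral_congr_ae (ae_of_all _ fun s => ?_)
    by_cases hs : ‖x‖ < Real.exp (-s) <;> simp [f, A, Set.indicator, hs, mul_comm]
  have hright : ∀ s, ∫ x in Lam u, f x s = Fdef u s := by
    intro s
    rw [Fdef_eq, ← setIntegral_indicator measurableSet_ball, ← integral_const_mul]
    refine integral_congr_ae (ae_of_all _ fun x => ?_)
    by_cases hs : ‖x‖ < Real.exp (-s) <;> simp [f, A, Set.indicator, hs, mul_comm]
  simp only [hleft]
  rw [integral_integral_swap hf_int, intervalIntegral.integral_of_le h, integral_Ioc_eq_integral_Ioo]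
  simp only [hright]

theorem hasGradientAt_p0 {n : ℕ} (x : En n) : HasGradientAt (p0 n) ((n : ℝ)⁻¹ • x) x := by
  rw [hasGradientAt_iff_hasFDerivAt]
  have h := ((hasFDerivAt_id x).norm_sq).mul_const ((2 * (n : ℝ))⁻¹)
  refine (h.congr_of_eventuallyEq (Eventually.of_forall fun y => ?_)).congr_fderiv ?_
  · simp [p0, div_eq_mul_inv]
  · ext y
    simp
    ring

/-- Green's identity for a solution: the variation of the spherical quadratic moments of the
rescalings is controlled by the contact set. -/
theorem integral_ut_sub_mul_psiM {n : ℕ} (hn : 2 ≤ n) {u : En n → ℝ} (hu : SolutionHyp u)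
    {C : Matrix (Fin n) (Fin n) ℝ} (hC : S0 C) {t₁ t₂ : ℝ} (h1 : 0 < t₁) (h12 : t₁ ≤ t₂) :
    ∫ x, (ut u t₂ x - ut u t₁ x) * psiM C x ∂(polarSphMeas n) =
      ∫ x in Lam u, radialCutoff n (Real.exp (-t₂)) (Real.exp (-t₁)) x * psiM C x := by
  obtain ⟨hdiff, ⟨L, hL⟩, htr, -, -⟩ := hu
  have hn0 : (n : ℝ) ≠ 0 := by positivity
  let w : En n → ℝ := fun x => u x - u 0 - p0 n x
  let G : En n → En n := fun x => gradient u x - (n : ℝ)⁻¹ • x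
  have hw : ∀ x ∈ ball (0 : En n) 1, HasGradientAt w (G x) x := by
    intro x hx
    have h2 := ((hdiff x hx).hasGradientAt.hasFDerivAt.sub_const (u 0)).sub
      (hasGradientAt_p0 x).hasFDerivAt
    rw [hasGradientAt_iff_hasFDerivAt, map_sub]
    exact h2
  have hlin : LipschitzWith ‖(n : ℝ)⁻¹‖₊ (fun x : En n => (n : ℝ)⁻¹ • x) := lipschitzWith_smul _
  have hG : LipschitzOnWith (L + ‖(n : ℝ)⁻¹‖₊) G (ball (0 : En n) 1) :=
    hL.sub hlin.lipschitzOnWith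
  have hd : ∀ᵐ x ∂(volume.restrict (ball (0 : En n) 1)), ∃ D : En n →L[ℝ] En n,
      HasFDerivAt G D x ∧ LinearMap.trace ℝ (En n) (D : En n →ₗ[ℝ] En n) =
        (Lam u).indicator (fun _ => -1) x := by
    filter_upwards [htr, ae_restrict_mem measurableSet_ball] with x hx hxb
    obtain ⟨D, hD, hz, hnz⟩ := hx
    refine ⟨D - (n : ℝ)⁻¹ • ContinuousLinearMap.id ℝ (En n), hD.sub ?_, ?_⟩
    · exact (hasFDerivAt_id x).const_smul (n : ℝ)⁻¹
    · have htrid : LinearMap.trace ℝ (En n)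
          ((D - (n : ℝ)⁻¹ • ContinuousLinearMap.id ℝ (En n) : En n →L[ℝ] En n) : En n →ₗ[ℝ] En n) =
          LinearMap.trace ℝ (En n) (D : En n →ₗ[ℝ] En n) - 1 := by
        simp [hn0]
      rw [htrid]
      by_cases hg : gradient u x = 0
      · rw [hz hg, Set.indicator_of_mem (show x ∈ Lam u from ⟨hxb, hg⟩)]
        norm_num
      · rw [hnz hg, Set.indicator_of_notMem (show x ∉ Lam u from fun h => hg h.2)]
        norm_num
  have hr12 : Real.exp (-t₂) ≤ Real.exp (-t₁) := Real.exp_le_exp.2 (by linarith)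
  have hr2 : Real.exp (-t₁) < 1 := by simpa using h1
  have e1 := integral_radialCutoff_mul_trace hC hw hG hd (Real.exp_pos _) hr12 hr2
  have e2 := setIntegral_annulus_eq hn hw hG.continuousOn (Real.exp_pos _) hr12 hr2 C
  have e3 : ∀ (t : ℝ) (x : En n), w (Real.exp (-t) • x) / Real.exp (-t) ^ 2 =
      ut u t x - p0 n x := by
    intro t x
    have h3 : Real.exp (2 * t) = (Real.exp (-t) ^ 2)⁻¹ := by
      rw [← Real.exp_nat_mul, ← Real.exp_neg]
      congr 1
      push_cast
      ring
    have hp : Real.exp (-t) ≠ 0 := (Real.exp_pos _).ne'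
    simp only [w, ut, h3, p0, norm_smul, Real.norm_eq_abs, Real.abs_exp]
    field_simp
  simp only [e3] at e2
  rw [← e1] at e2
  have hLm : MeasurableSet (Lam u) := measurableSet_Lam hL.continuousOn
  have e4 : ∀ x, radialCutoff n (Real.exp (-t₂)) (Real.exp (-t₁)) x *
      (psiM C x * (Lam u).indicator (fun _ => -1) x) =
      -(Lam u).indicator
        (fun x => radialCutoff n (Real.exp (-t₂)) (Real.exp (-t₁)) x * psiM C x) x := by
    intro x
    by_cases hx : x ∈ Lam u <;> simp [hx]
  have hsub : ball (0 : En n) 1 ∩ Lam u = Lam u :=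
    Set.inter_eq_self_of_subset_right fun x hx => hx.1
  simp only [e4, integral_neg, setIntegral_indicator hLm, hsub] at e2
  have e5 := congrArg Neg.neg e2
  rw [neg_neg, ← integral_neg] at e5
  rw [e5]
  refine integral_congr_ae (ae_of_all _ fun x => ?_)
  ring

theorem continuousOn_ut {n : ℕ} {u : En n → ℝ} (hu : SolutionHyp u) {t : ℝ} (ht : 0 < t) :
    ContinuousOn (ut u t) (sphere (0 : En n) 1) := by
  intro x hx
  have hb : Real.exp (-t) • x ∈ ball (0 : En n) 1 := by
    have hx1 : ‖x‖ = 1 := by simpa using hx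
    rw [mem_ball_zero_iff, norm_smul, hx1, mul_one, Real.norm_eq_abs, Real.abs_exp]
    simpa using ht
  have h := (hu.1 _ hb).continuousAt
  have h2 : ContinuousAt (fun y : En n => u (Real.exp (-t) • y)) x :=
    ContinuousAt.comp (f := fun y : En n => Real.exp (-t) • y) h (by fun_prop)
  exact (continuousAt_const.mul (h2.sub continuousAt_const)).continuousWithinAt

theorem integral_psiM_sub_sq {n : ℕ} (hn : 2 ≤ n) {u : En n → ℝ} (hu : SolutionHyp u)
    {B : ℝ → Matrix (Fin n) (Fin n) ℝ} (hB : BProp u B) {t₁ t₂ : ℝ} (h1 : 0 < t₁) (h12 : t₁ ≤ t₂) :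
    ∫ x, psiM (B t₂ - B t₁) x ^ 2 ∂(polarSphMeas n) =
      ∫ x, (ut u t₂ x - ut u t₁ x) * psiM (B t₂ - B t₁) x ∂(polarSphMeas n) := by
  obtain ⟨c, hc0, hct, hc⟩ := exists_sphMeas_eq_smul hn
  have h2 : 0 < t₂ := h1.trans_le h12
  have hS : S0 (B t₂ - B t₁) :=
    ⟨(hB t₂ h2).1.1.sub (hB t₁ h1).1.1, by
      rw [Matrix.trace_sub, (hB t₂ h2).1.2, (hB t₁ h1).1.2, sub_zero]⟩
  have hz : ∀ t, 0 < t → ∫ x, (ut u t x - p0 n x - psiM (B t) x) * psiM (B t₂ - B t₁) x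
      ∂(polarSphMeas n) = 0 := by
    intro t ht
    have h := (hB t ht).2 _ hS
    rw [hc, integral_smul_measure, smul_eq_zero] at h
    exact h.resolve_left (ENNReal.toReal_ne_zero.2 ⟨hc0, hct⟩)
  have hp0 : Continuous (p0 n) := by unfold p0; fun_prop
  have hi : ∀ t, 0 < t → Integrable
      (fun x => (ut u t x - p0 n x - psiM (B t) x) * psiM (B t₂ - B t₁) x) (polarSphMeas n) :=
    fun t ht => ContinuousOn.integrable_polarSphMeas
      ((((continuousOn_ut hu ht).sub hp0.continuousOn).sub (continuous_psiM _).continuousOn).mul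
        (continuous_psiM _).continuousOn)
  have hi2 : Integrable (fun x => (ut u t₂ x - ut u t₁ x) * psiM (B t₂ - B t₁) x)
      (polarSphMeas n) := ContinuousOn.integrable_polarSphMeas
    (((continuousOn_ut hu h2).sub (continuousOn_ut hu h1)).mul (continuous_psiM _).continuousOn)
  have hi3 : Integrable (fun x => psiM (B t₂ - B t₁) x ^ 2) (polarSphMeas n) :=
    ContinuousOn.integrable_polarSphMeas ((continuous_psiM _).pow 2).continuousOn
  have hdiff := integral_sub (hi t₂ h2) (hi t₁ h1)
  rw [hz t₂ h2, hz t₁ h1, sub_zero] at hdiff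
  symm
  rw [← sub_eq_zero, ← integral_sub hi2
    hi3, ← hdiff]
  refine integral_congr_ae (ae_of_all _ fun x => ?_)
  simp only [psiM_sub_matrix]
  ring

/-- |B(t₂) − B(t₁)| ≤ C_n ∫_{t₁}^{t₂} F(s) ds. -/
theorem stmt_8 (n : ℕ) (hn : 2 ≤ n) :
    ∃ Cn : ℝ, ∀ u : En n → ℝ, SolutionHyp u →
      ∀ B : ℝ → Matrix (Fin n) (Fin n) ℝ, BProp u B →
        ∀ t₁ t₂ : ℝ, 0 < t₁ → t₁ ≤ t₂ →
          IntegrableOn (Fdef u) (Set.Icc t₁ t₂) ∧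
          frob (B t₂ - B t₁) ≤ Cn * ∫ s in t₁..t₂, Fdef u s := by
  obtain ⟨c, hc, hcoer⟩ := exists_coercive_integral_psiM_sq n
  refine ⟨1 / (2 * c), fun u hu B hB t₁ t₂ h1 h12 => ⟨integrableOn_Fdef u t₁ t₂, ?_⟩⟩
  set D := B t₂ - B t₁ with hD
  have h2 : 0 < t₂ := h1.trans_le h12
  have hS : S0 D :=
    ⟨(hB t₂ h2).1.1.sub (hB t₁ h1).1.1, by
      rw [hD, Matrix.trace_sub, (hB t₂ h2).1.2, (hB t₁ h1).1.2, sub_zero]⟩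
  have hr12 : Real.exp (-t₂) ≤ Real.exp (-t₁) := Real.exp_le_exp.2 (by linarith)
  have hLm : MeasurableSet (Lam u) := by
    obtain ⟨-, ⟨L, hL⟩, -⟩ := hu
    exact measurableSet_Lam hL.continuousOn
  obtain ⟨K, hη⟩ := exists_lipschitzWith_radialCutoff (n := n) (Real.exp_pos (-t₂)) hr12
  have hf_int : ∀ g : En n → ℝ, Continuous g → IntegrableOn
      (fun x => radialCutoff n (Real.exp (-t₂)) (Real.exp (-t₁)) x * g x) (Lam u) := fun g hg =>
    ((hη.continuous.mul hg).integrable_of_hasCompactSupport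
      (hasCompactSupport_radialCutoff hr12).mul_right).integrableOn
  have hF : 0 ≤ ∫ s in t₁..t₂, Fdef u s :=
    intervalIntegral.integral_nonneg h12 fun s _ => integral_nonneg fun x => sq_nonneg _
  have hmain : c * frob D ^ 2 ≤ 1 / 2 * frob D * ∫ s in t₁..t₂, Fdef u s := by
    refine (hcoer D hS.1).trans ?_
    rw [integral_psiM_sub_sq hn hu hB h1 h12, integral_ut_sub_mul_psiM hn hu hS h1 h12,
      ← setIntegral_radialCutoff_mul_norm_sq h12, ← integral_const_mul]
    refine setIntegral_mono_on (hf_int _ (continuous_psiM D))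
      ((hf_int (fun x => ‖x‖ ^ 2) (by fun_prop)).const_mul _) hLm fun x _ => ?_
    have hle := (le_abs_self _).trans (abs_psiM_le D x)
    have hnn := radialCutoff_nonneg (n := n) (Real.exp_pos (-t₂)) hr12 x
    calc _ ≤ radialCutoff n (Real.exp (-t₂)) (Real.exp (-t₁)) x * (1 / 2 * frob D * ‖x‖ ^ 2) := by
          gcongr
      _ = _ := by ring
  have hD0 : 0 ≤ frob D := Real.sqrt_nonneg _
  rcases hD0.eq_or_lt with h | h
  · rw [← h]; positivity
  · have h3 : c * frob D ≤ 1 / 2 * ∫ s in t₁..t₂, Fdef u s := by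
      refine le_of_mul_le_mul_right ?_ h
      linarith [hmain]
    rw [one_div_mul_eq_div, le_div_iff₀ (by positivity)]
    linarith

end
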